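/- (Conservation of energy.) Let ε ∈ {+1, −1} and let u : ℝ → 𝒮(ℝ³) be a smooth map into Schwartz space, written u(t,x), such that ∂_t² u − Δu + ε u⁵ = 0 pointwise on ℝ × ℝ³. Then the energy E(t) = ∫_{ℝ³} ½ (∂_t u(t,x))² + ½ |∇_x u(t,x)|² + (ε/6) u(t,x)⁶ dx is finite and independent of t; in particular E(t) = E(0) for all t ∈ ℝ. -/

import Mathlib

open MeasureTheory SchwartzMap Metric Set
open scoped ENNReal NNReal FourierTransform RealInnerProductSpace

noncomputable section

abbrev E3 := EuclideanSpace ℝ (Fin 3)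

/-- Fourier multiplier with symbol `m`. -/
def fmul3 (m : E3 → ℂ) (f : E3 → ℂ) : E3 → ℂ :=
  𝓕⁻ (fun ξ => m ξ * 𝓕 f ξ)

/-- The fractional derivative `|∇|^s`. -/
def absGrad3 (s : ℝ) (f : E3 → ℂ) : E3 → ℂ :=
  fmul3 (fun ξ => (((2 * Real.pi * ‖ξ‖) ^ s : ℝ) : ℂ)) f

/-- The half-wave propagator `e^{σ i t |∇|}`. -/
def halfWave3 (σ t : ℝ) (f : E3 → ℂ) : E3 → ℂ :=
  fmul3 (fun ξ => Complex.exp (Complex.I * (σ * (2 * Real.pi * t * ‖ξ‖)))) f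

/-- The propagator `cos(t|∇|)`. -/
def cosProp3 (t : ℝ) (f : E3 → ℂ) : E3 → ℂ :=
  fmul3 (fun ξ => ((Real.cos (2 * Real.pi * t * ‖ξ‖) : ℝ) : ℂ)) f

/-- The propagator `sin(t|∇|)/|∇|`. -/
def sinProp3 (t : ℝ) (g : E3 → ℂ) : E3 → ℂ :=
  fmul3 (fun ξ => ((Real.sin (2 * Real.pi * t * ‖ξ‖) / (2 * Real.pi * ‖ξ‖) : ℝ) : ℂ)) g

/-- A Littlewood–Paley bump function. -/
structure IsLPBump3 (φ : E3 → ℝ) : Prop where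
  smooth : ContDiff ℝ (⊤ : ℕ∞) φ
  mem_Icc : ∀ ξ, φ ξ ∈ Icc (0:ℝ) 1
  eq_one : ∀ ξ : E3, ‖ξ‖ ≤ 1 → φ ξ = 1
  eq_zero : ∀ ξ : E3, 2 ≤ ‖ξ‖ → φ ξ = 0

/-- The Littlewood–Paley projection `P_N`. -/
def LP3 (φ : E3 → ℝ) (N : ℝ) (f : E3 → ℂ) : E3 → ℂ :=
  fmul3 (fun ξ => ((φ (N⁻¹ • ξ) - φ ((2 / N) • ξ) : ℝ) : ℂ)) f

/-- The homogeneous Besov norm `Ḃ^s_{p,1}`. -/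
def besov3 (φ : E3 → ℝ) (s : ℝ) (p : ℝ≥0∞) (f : E3 → ℂ) : ℝ≥0∞ :=
  ∑' n : ℤ, ENNReal.ofReal (((2:ℝ) ^ n) ^ s) * eLpNorm (LP3 φ ((2:ℝ) ^ n) f) p volume

/-- The mixed spacetime norm `L_t^p L_x^q (J × ℝ³)`. -/
def mixedNorm3 (p q : ℝ≥0∞) (J : Set ℝ) (F : ℝ → E3 → ℂ) : ℝ≥0∞ :=
  if p = ∞ then essSup (fun t => eLpNorm (F t) q volume) (volume.restrict J)
  else (∫⁻ t in J, (eLpNorm (F t) q volume) ^ p.toReal) ^ (1 / p.toReal)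

/-- Time derivative `∂ₜ u`. -/
def dt (u : ℝ → E3 → ℝ) (t : ℝ) (x : E3) : ℝ := deriv (fun s => u s x) t

/-- Second time derivative `∂ₜ² u`. -/
def dtt (u : ℝ → E3 → ℝ) (t : ℝ) (x : E3) : ℝ := deriv (fun s => dt u s x) t

/-- The spatial Laplacian: sum of second partial derivatives. -/
def lap3 (f : E3 → ℝ) (x : E3) : ℝ :=
  ∑ i : Fin 3,
    fderiv ℝ (fun y => fderiv ℝ f y (EuclideanSpace.single i (1:ℝ))) x
      (EuclideanSpace.single i (1:ℝ))

/-- A Schwartz solution of the energy-critical NLW `∂ₜ²u - Δu + ε u⁵ = 0` on `ℝ × ℝ³`: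
a jointly smooth function, all of whose time derivatives are Schwartz in space at each time,
solving the equation pointwise. -/
structure IsNLWSolution (ε : ℝ) (u : ℝ → E3 → ℝ) : Prop where
  smooth : ContDiff ℝ (⊤ : ℕ∞) (fun p : ℝ × E3 => u p.1 p.2)
  schwartz : ∀ (k : ℕ) (t : ℝ), ∃ g : 𝓢(E3, ℝ), ∀ x,
    iteratedDeriv k (fun s => u s x) t = g x
  eqn : ∀ t x, dtt u t x - lap3 (u t) x + ε * (u t x) ^ 5 = 0

/-- `‖∇f‖_{L²}`. -/
def gradL2 (f : E3 → ℝ) : ℝ≥0∞ := eLpNorm (fun x => ‖fderiv ℝ f x‖) 2 volume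

/-- `‖(f,g)‖_{Ḣ¹ × L²} = ‖∇f‖_{L²} + ‖g‖_{L²}`. -/
def H1L2 (f g : E3 → ℝ) : ℝ≥0∞ := gradL2 f + eLpNorm g 2 volume

/-- The ground state `W(x) = (1 + |x|²/3)^{-1/2}`. -/
def Wfn : E3 → ℝ := fun x => (1 + ‖x‖ ^ 2 / 3) ^ (-(1/2) : ℝ)

/-- The (focusing-sign) energy `E(f,g) = ∫ ½|∇f|² + ½g² - ⅙f⁶`. -/
def energyKM (f g : E3 → ℝ) : ℝ :=
  ∫ x, ((1/2) * ‖fderiv ℝ f x‖ ^ 2 + (1/2) * g x ^ 2 - (1/6) * f x ^ 6)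

/-- The Kenig–Merle condition: `E(u₀,u₁) < E(W,0)` and `‖∇u₀‖₂ < ‖∇W‖₂`. -/
def KenigMerle (f g : E3 → ℝ) : Prop :=
  energyKM f g < energyKM Wfn (fun _ => 0) ∧ gradL2 f < gradL2 Wfn

/-- Coercion of a real-valued function to a complex-valued one. -/
def rc (f : E3 → ℝ) : E3 → ℂ := fun x => (f x : ℂ)


/-- Differentiation under the integral sign for a finite measure with bounded support. -/
theorem hasDerivAt_integral_of_contDiff {E : Type*} [NormedAddCommGroup E] [NormedSpace ℝ E]
    [ProperSpace E] [MeasurableSpace E] [BorelSpace E]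
    (ν : Measure E) [IsFiniteMeasure ν] {L : ℝ} (hL : ∀ᵐ x ∂ν, ‖x‖ ≤ L)
    {q : ℝ × E → ℝ} (hq : ContDiff ℝ 1 q) (t₀ : ℝ) :
    HasDerivAt (fun t => ∫ x, q (t, x) ∂ν) (∫ x, fderiv ℝ q (t₀, x) (1, 0) ∂ν) t₀ := by
  have hcont : Continuous fun p : ℝ × E => fderiv ℝ q p (1, 0) := by
    have := hq.continuous_fderiv (by norm_num)
    fun_prop
  have hbdd {f : ℝ × E → ℝ} (hf : Continuous f) : ∃ C, ∀ t ∈ closedBall t₀ 1, ∀ x : E,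
      ‖x‖ ≤ L → ‖f (t, x)‖ ≤ C := by
    obtain ⟨C, hC⟩ := ((isCompact_closedBall t₀ 1).prod
      (isCompact_closedBall (0 : E) L)).exists_bound_of_continuousOn hf.continuousOn
    exact ⟨C, fun t ht x hx => hC (t, x) ⟨ht, by simpa using hx⟩⟩
  obtain ⟨C, hC⟩ := hbdd hcont
  obtain ⟨C₀, hC₀⟩ := hbdd hq.continuous
  refine (hasDerivAt_integral_of_dominated_loc_of_deriv_le (s := closedBall t₀ 1)
    (F := fun t x => q (t, x)) (F' := fun t x => fderiv ℝ q (t, x) (1, 0))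
    (bound := fun _ => C)
    (closedBall_mem_nhds _ one_pos) ?_ ?_ ?_ ?_ (integrable_const _) ?_).2
  · exact Filter.Eventually.of_forall fun t =>
      (hq.continuous.comp (by fun_prop)).aestronglyMeasurable
  · refine Integrable.of_bound (hq.continuous.comp (by fun_prop)).aestronglyMeasurable C₀ ?_
    filter_upwards [hL] with x hx using hC₀ t₀ (mem_closedBall_self zero_le_one) x hx
  · exact (hcont.comp (by fun_prop : Continuous fun x : E => (t₀, x))).aestronglyMeasurable
  · filter_upwards [hL] with x hx t ht using hC t ht x hx
  · refine Filter.Eventually.of_forall fun x t _ => ?_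
    have h1 : HasFDerivAt q (fderiv ℝ q (t, x)) (t, x) :=
      (hq.differentiable (by norm_num) _).hasFDerivAt
    have h2 : HasDerivAt (fun s : ℝ => (s, x)) ((1 : ℝ), (0 : E)) t :=
      (hasDerivAt_id t).prodMk (hasDerivAt_const t x)
    exact h1.comp_hasDerivAt t h2

/-- The `i`-th standard basis vector. -/
abbrev bas3 (i : Fin 3) : E3 := EuclideanSpace.single i (1 : ℝ)

/-- A rotation invariant finite measure carried by the unit sphere. -/
def sphereMeasure3 : Measure E3 :=
  Measure.map (fun y : E3 => ‖y‖⁻¹ • y) (volume.restrict (ball (0 : E3) 1))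

theorem measurable_normalize3 : Measurable fun y : E3 => ‖y‖⁻¹ • y := by fun_prop

instance : IsFiniteMeasure sphereMeasure3 := by
  have : IsFiniteMeasure (volume.restrict (ball (0 : E3) 1)) :=
    ⟨by simp⟩
  unfold sphereMeasure3
  infer_instance

theorem sphereMeasure3_real_univ_pos : 0 < sphereMeasure3.real univ := by
  rw [measureReal_def, sphereMeasure3, Measure.map_apply measurable_normalize3 MeasurableSet.univ]
  simp only [preimage_univ, Measure.restrict_apply, MeasurableSet.univ, univ_inter]
  exact ENNReal.toReal_pos (measure_ball_pos _ _ one_pos).ne' measure_ball_lt_top.ne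

theorem ae_norm_eq_one_sphereMeasure3 : ∀ᵐ y ∂sphereMeasure3, ‖y‖ = 1 := by
  rw [sphereMeasure3, ae_map_iff measurable_normalize3.aemeasurable
    (measurableSet_eq_fun measurable_norm measurable_const)]
  refine ae_restrict_of_ae ?_
  have : ∀ᵐ y : E3, y ≠ 0 := by
    simp [ae_iff]
  filter_upwards [this] with y hy
  rw [norm_smul, norm_inv, norm_norm, inv_mul_cancel₀ (norm_ne_zero_iff.2 hy)]

theorem integral_sphereMeasure3_comp_isometry (R : E3 ≃ₗᵢ[ℝ] E3) {K : E3 → ℝ}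
    (hK : Continuous K) :
    ∫ y, K (R y) ∂sphereMeasure3 = ∫ y, K y ∂sphereMeasure3 := by
  rw [sphereMeasure3, integral_map measurable_normalize3.aemeasurable
    (f := fun y => K (R y)) (hK.comp R.continuous).aestronglyMeasurable,
    integral_map measurable_normalize3.aemeasurable hK.aestronglyMeasurable]
  have h := (R.measurePreserving.setIntegral_preimage_emb
    R.toHomeomorph.measurableEmbedding (fun y => K (‖y‖⁻¹ • y)) (ball 0 1))
  rw [← h, R.preimage_ball]
  simp [R.norm_map]

/-- Rotation by the angle `θ` in the plane of the `i`-th and `j`-th coordinates. -/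
def rotFun3 (i j : Fin 3) (θ : ℝ) (v : E3) : E3 :=
  v + EuclideanSpace.proj i v • ((Real.cos θ - 1) • bas3 i + Real.sin θ • bas3 j)
    + EuclideanSpace.proj j v • ((Real.cos θ - 1) • bas3 j - Real.sin θ • bas3 i)

theorem norm_rotFun3 {i j : Fin 3} (hij : i ≠ j) (θ : ℝ) (v : E3) : ‖rotFun3 i j θ v‖ = ‖v‖ := by
  rw [EuclideanSpace.norm_eq, EuclideanSpace.norm_eq]
  congr 1
  have h := Real.sin_sq_add_cos_sq θ
  fin_cases i <;> fin_cases j <;>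
    first
    | exact absurd rfl hij
    | (simp [rotFun3, Fin.sum_univ_three, bas3]
       first
       | linear_combination (v 0 ^ 2 + v 1 ^ 2) * h
       | linear_combination (v 0 ^ 2 + v 2 ^ 2) * h
       | linear_combination (v 1 ^ 2 + v 2 ^ 2) * h)

/-- `rotFun3` as a linear isometry. -/
def rot3 {i j : Fin 3} (hij : i ≠ j) (θ : ℝ) : E3 ≃ₗᵢ[ℝ] E3 :=
  LinearIsometry.toLinearIsometryEquiv
    { toFun := rotFun3 i j θ
      map_add' := fun v w => by simp only [rotFun3, map_add]; module
      map_smul' := fun c v => by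
        simp only [rotFun3, map_smul, RingHom.id_apply, smul_eq_mul]; module
      norm_map' := norm_rotFun3 hij θ } rfl

theorem integral_angular_deriv_sphereMeasure3 {i j : Fin 3} (hij : i ≠ j) {K : E3 → ℝ}
    (hK : ContDiff ℝ 1 K) :
    ∫ y, (y i * fderiv ℝ K y (bas3 j) - y j * fderiv ℝ K y (bas3 i)) ∂sphereMeasure3 = 0 := by
  have hrot : ContDiff ℝ 1 fun p : ℝ × E3 => rotFun3 i j p.1 p.2 := by
    unfold rotFun3; fun_prop
  have hq : ContDiff ℝ 1 fun p : ℝ × E3 => K (rotFun3 i j p.1 p.2) := hK.comp hrot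
  have h1 := hasDerivAt_integral_of_contDiff sphereMeasure3 (L := 1)
    (ae_norm_eq_one_sphereMeasure3.mono fun y hy => hy.le) hq 0
  have h2 : (fun t => ∫ y, K (rotFun3 i j t y) ∂sphereMeasure3) =
      fun _ => ∫ y, K y ∂sphereMeasure3 := by
    funext t
    exact integral_sphereMeasure3_comp_isometry (rot3 hij t) hK.continuous
  simp only [h2] at h1
  rw [← h1.unique (hasDerivAt_const _ _)]
  refine integral_congr_ae (Filter.Eventually.of_forall fun y => ?_)
  have h3 : HasDerivAt (fun s : ℝ => (s, y)) ((1 : ℝ), (0 : E3)) 0 :=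
    (hasDerivAt_id (0 : ℝ)).prodMk (hasDerivAt_const 0 y)
  have h4 := (hq.differentiable (by norm_num) (0, y)).hasFDerivAt.comp_hasDerivAt 0 h3
  have hc : HasDerivAt (fun s => Real.cos s - 1) 0 (0 : ℝ) := by
    simpa using (Real.hasDerivAt_cos 0).sub_const 1
  have hs : HasDerivAt Real.sin 1 (0 : ℝ) := by simpa using Real.hasDerivAt_sin 0
  have h5 : HasDerivAt (fun s => rotFun3 i j s y) (y i • bas3 j - y j • bas3 i) 0 := by
    have := (((hasDerivAt_const (0 : ℝ) y).add
      (((hc.smul_const (bas3 i)).add (hs.smul_const (bas3 j))).const_smul (y i))).add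
      (((hc.smul_const (bas3 j)).sub (hs.smul_const (bas3 i))).const_smul (y j)))
    refine HasDerivAt.congr_deriv (f := fun s => rotFun3 i j s y) this ?_
    module
  have h6 : rotFun3 i j 0 y = y := by simp [rotFun3]
  have h7 : HasFDerivAt K (fderiv ℝ K y) (rotFun3 i j 0 y) := by
    rw [h6]; exact (hK.differentiable (by norm_num) y).hasFDerivAt
  have h8 := h7.comp_hasDerivAt 0 h5
  have h9 := h4.unique h8
  simp only [map_sub, map_smul, smul_eq_mul] at h9
  exact h9.symm

theorem fderiv_fderiv_apply_const {E : Type*} [NormedAddCommGroup E] [NormedSpace ℝ E]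
    {f : E → ℝ} (hf : ContDiff ℝ 2 f) (x v w : E) :
    fderiv ℝ (fun y => fderiv ℝ f y v) x w = fderiv ℝ (fderiv ℝ f) x w v := by
  have h : DifferentiableAt ℝ (fderiv ℝ f) x :=
    (hf.fderiv_right (m := 1) (by norm_num)).differentiable (by norm_num) x
  rw [fderiv_clm_apply h (differentiableAt_const v)]
  simp

theorem fderiv_fderiv_symm {E : Type*} [NormedAddCommGroup E] [NormedSpace ℝ E]
    {f : E → ℝ} (hf : ContDiff ℝ 2 f) (x v w : E) :
    fderiv ℝ (fderiv ℝ f) x v w = fderiv ℝ (fderiv ℝ f) x w v :=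
  (hf.contDiffAt.isSymmSndFDerivAt (by simp)) v w

theorem eq_sum_bas3 (y : E3) : y = y 0 • bas3 0 + y 1 • bas3 1 + y 2 • bas3 2 := by
  ext i; fin_cases i <;> simp [bas3]

theorem norm_sq_eq_E3 (y : E3) : ‖y‖ ^ 2 = y 0 ^ 2 + y 1 ^ 2 + y 2 ^ 2 := by
  rw [EuclideanSpace.norm_sq_eq, Fin.sum_univ_three]
  simp

theorem angular_deriv_sq {G : E3 → ℝ} (hG : ContDiff ℝ 2 G) {i j : Fin 3} (hij : i ≠ j) (y : E3) :
    y i * fderiv ℝ (fun z : E3 => z i * fderiv ℝ G z (bas3 j) - z j * fderiv ℝ G z (bas3 i)) y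
        (bas3 j)
      - y j * fderiv ℝ (fun z : E3 => z i * fderiv ℝ G z (bas3 j) - z j * fderiv ℝ G z (bas3 i)) y
        (bas3 i) =
    y i ^ 2 * fderiv ℝ (fderiv ℝ G) y (bas3 j) (bas3 j)
      + y j ^ 2 * fderiv ℝ (fderiv ℝ G) y (bas3 i) (bas3 i)
      - 2 * (y i * y j * fderiv ℝ (fderiv ℝ G) y (bas3 i) (bas3 j))
      - y i * fderiv ℝ G y (bas3 i) - y j * fderiv ℝ G y (bas3 j) := by
  have hd (v : E3) : DifferentiableAt ℝ (fun z => fderiv ℝ G z v) y := by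
    have h : DifferentiableAt ℝ (fderiv ℝ G) y :=
      (hG.fderiv_right (m := 1) (by norm_num)).differentiable (by norm_num) y
    fun_prop
  have hp (k : Fin 3) : HasFDerivAt (fun z : E3 => z k)
      (EuclideanSpace.proj k : E3 →L[ℝ] ℝ) y :=
    (EuclideanSpace.proj k : E3 →L[ℝ] ℝ).hasFDerivAt
  have h := ((hp i).mul (hd (bas3 j)).hasFDerivAt).sub ((hp j).mul (hd (bas3 i)).hasFDerivAt)
  have h' : fderiv ℝ (fun z : E3 => z i * fderiv ℝ G z (bas3 j) - z j * fderiv ℝ G z (bas3 i)) y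
    = _ := h.fderiv
  rw [h']
  simp only [sub_apply, add_apply,
    smul_apply, fderiv_fderiv_apply_const hG, smul_eq_mul,
    fderiv_fderiv_symm hG y (bas3 j) (bas3 i)]
  simp [bas3, hij, hij.symm]
  ring

/-- The spherical Laplacian integrates to zero over the sphere. -/
theorem integral_spherical_laplacian {G : E3 → ℝ} (hG : ContDiff ℝ 3 G) :
    ∫ y, (∑ i, fderiv ℝ (fderiv ℝ G) y (bas3 i) (bas3 i) - fderiv ℝ (fderiv ℝ G) y y y
      - 2 * fderiv ℝ G y y) ∂sphereMeasure3 = 0 := by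
  have hG2 : ContDiff ℝ 2 G := hG.of_le (by norm_num)
  have hf : ContDiff ℝ 2 (fderiv ℝ G) := hG.fderiv_right (by norm_num)
  have hK (i j : Fin 3) : ContDiff ℝ 2
      fun z : E3 => z i * fderiv ℝ G z (bas3 j) - z j * fderiv ℝ G z (bas3 i) := by fun_prop
  have hInt (i j : Fin 3) : Integrable (fun y : E3 =>
      y i * fderiv ℝ (fun z : E3 => z i * fderiv ℝ G z (bas3 j) - z j * fderiv ℝ G z (bas3 i)) y
        (bas3 j)
      - y j * fderiv ℝ (fun z : E3 => z i * fderiv ℝ G z (bas3 j) - z j * fderiv ℝ G z (bas3 i)) y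
        (bas3 i)) sphereMeasure3 := by
    have h1 := (hK i j).continuous_fderiv (by norm_num)
    have hc : Continuous (fun y : E3 =>
      y i * fderiv ℝ (fun z : E3 => z i * fderiv ℝ G z (bas3 j) - z j * fderiv ℝ G z (bas3 i)) y
        (bas3 j)
      - y j * fderiv ℝ (fun z : E3 => z i * fderiv ℝ G z (bas3 j) - z j * fderiv ℝ G z (bas3 i)) y
        (bas3 i)) := by fun_prop
    obtain ⟨C, hC⟩ := (isCompact_closedBall (0 : E3) 1).exists_bound_of_continuousOn hc.continuousOn
    refine Integrable.of_bound hc.aestronglyMeasurable C ?_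
    filter_upwards [ae_norm_eq_one_sphereMeasure3] with y hy using hC y (by simp [hy])
  have h01 := integral_angular_deriv_sphereMeasure3 (i := 0) (j := 1) (by decide)
    ((hK 0 1).of_le (by norm_num))
  have h02 := integral_angular_deriv_sphereMeasure3 (i := 0) (j := 2) (by decide)
    ((hK 0 2).of_le (by norm_num))
  have h12 := integral_angular_deriv_sphereMeasure3 (i := 1) (j := 2) (by decide)
    ((hK 1 2).of_le (by norm_num))
  have hsum := integral_add ((hInt 0 1).add (hInt 0 2)) (hInt 1 2)
  simp only [Pi.add_apply] at hsum
  rw [integral_add (hInt 0 1) (hInt 0 2), h01, h02, h12, add_zero, add_zero] at hsum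
  rw [← hsum]
  refine integral_congr_ae ?_
  filter_upwards [ae_norm_eq_one_sphereMeasure3] with y hy
  rw [angular_deriv_sq hG2 (by decide), angular_deriv_sq hG2 (by decide),
    angular_deriv_sq hG2 (by decide), Fin.sum_univ_three]
  have hn := norm_sq_eq_E3 y
  rw [hy] at hn
  have e1 : fderiv ℝ G y y = y 0 * fderiv ℝ G y (bas3 0) + y 1 * fderiv ℝ G y (bas3 1)
      + y 2 * fderiv ℝ G y (bas3 2) := by
    conv_lhs => rw [show fderiv ℝ G y y = fderiv ℝ G y
      (y 0 • bas3 0 + y 1 • bas3 1 + y 2 • bas3 2) by rw [← eq_sum_bas3]]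
    simp only [map_add, map_smul, smul_eq_mul]
  have e2 : fderiv ℝ (fderiv ℝ G) y y y = fderiv ℝ (fderiv ℝ G) y
      (y 0 • bas3 0 + y 1 • bas3 1 + y 2 • bas3 2)
      (y 0 • bas3 0 + y 1 • bas3 1 + y 2 • bas3 2) := by rw [← eq_sum_bas3]
  simp only [map_add, map_smul, smul_eq_mul, add_apply,
    smul_apply] at e2
  rw [fderiv_fderiv_symm hG2 y (bas3 1) (bas3 0), fderiv_fderiv_symm hG2 y (bas3 2) (bas3 0),
    fderiv_fderiv_symm hG2 y (bas3 2) (bas3 1)] at e2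
  rw [e1, e2]
  linear_combination (fderiv ℝ (fderiv ℝ G) y (bas3 0) (bas3 0)
    + fderiv ℝ (fderiv ℝ G) y (bas3 1) (bas3 1)
    + fderiv ℝ (fderiv ℝ G) y (bas3 2) (bas3 2)) * hn

/-- The wave operator `∂ₜ² - Δ` on `ℝ × ℝ³`. -/
def box3 (U : ℝ × E3 → ℝ) (p : ℝ × E3) : ℝ :=
  fderiv ℝ (fderiv ℝ U) p (1, 0) (1, 0) -
    ∑ i, fderiv ℝ (fderiv ℝ U) p (0, bas3 i) (0, bas3 i)

theorem continuous_box3 {U : ℝ × E3 → ℝ} (hU : ContDiff ℝ 3 U) : Continuous (box3 U) := by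
  have h1 : ContDiff ℝ 2 (fderiv ℝ U) := hU.fderiv_right (by norm_num)
  have h2 := h1.continuous_fderiv (by norm_num)
  unfold box3
  fun_prop

theorem integrable_sphereMeasure3 {f : E3 → ℝ} (hf : Continuous f) :
    Integrable f sphereMeasure3 := by
  obtain ⟨C, hC⟩ := (isCompact_closedBall (0 : E3) 1).exists_bound_of_continuousOn hf.continuousOn
  refine Integrable.of_bound hf.aestronglyMeasurable C ?_
  filter_upwards [ae_norm_eq_one_sphereMeasure3] with y hy using hC y (by simp [hy])

theorem fderiv_comp_slice {f : ℝ × E3 → ℝ} (hf : Differentiable ℝ f) (s r : ℝ) (x y v : E3) :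
    fderiv ℝ (fun z => f (s, x + r • z)) y v = r * fderiv ℝ f (s, x + r • y) (0, v) := by
  have h1 : HasFDerivAt (fun z : E3 => (s, x + r • z))
      ((0 : E3 →L[ℝ] ℝ).prod (r • ContinuousLinearMap.id ℝ E3)) y :=
    (hasFDerivAt_const s y).prodMk (((hasFDerivAt_id y).const_smul r).const_add x)
  have h2 := (hf (s, x + r • y)).hasFDerivAt.comp y h1
  have h3 : fderiv ℝ (fun z => f (s, x + r • z)) y = _ := h2.fderiv
  rw [h3]
  have : ((0 : ℝ), r • v) = r • ((0 : ℝ), v) := by simp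
  simp [this, -Prod.smul_mk]

/-- The integrand of the spherical mean whose time evolution yields Kirchhoff's formula. -/
def kirchhoffIntegrand (U : ℝ × E3 → ℝ) (t : ℝ) (x : E3) (q : ℝ × E3) : ℝ :=
  U (q.1, x + (t - q.1) • q.2) + (t - q.1) * fderiv ℝ U (q.1, x + (t - q.1) • q.2) (1, q.2)

theorem contDiff_kirchhoffIntegrand {U : ℝ × E3 → ℝ} (hU : ContDiff ℝ 3 U) (t : ℝ) (x : E3) :
    ContDiff ℝ 1 (kirchhoffIntegrand U t x) := by
  have h1 : ContDiff ℝ 1 (fderiv ℝ U) := hU.fderiv_right (by norm_num)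
  have h2 : ContDiff ℝ 1 U := hU.of_le (by norm_num)
  unfold kirchhoffIntegrand
  fun_prop

theorem fderiv_kirchhoffIntegrand {U : ℝ × E3 → ℝ} (hU : ContDiff ℝ 3 U) (t s : ℝ) (x y : E3) :
    fderiv ℝ (kirchhoffIntegrand U t x) (s, y) (1, 0) =
      -2 * fderiv ℝ U (s, x + (t - s) • y) (0, y) +
      (t - s) * (fderiv ℝ (fderiv ℝ U) (s, x + (t - s) • y) (1, 0) (1, 0) -
        fderiv ℝ (fderiv ℝ U) (s, x + (t - s) • y) (0, y) (0, y)) := by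
  have h1 : ContDiff ℝ 2 (fderiv ℝ U) := hU.fderiv_right (by norm_num)
  have h3 : HasDerivAt (fun s : ℝ => (s, y)) ((1 : ℝ), (0 : E3)) s :=
    (hasDerivAt_id s).prodMk (hasDerivAt_const s y)
  have h4 := (((contDiff_kirchhoffIntegrand hU t x).differentiable (by norm_num)
    (s, y)).hasFDerivAt).comp_hasDerivAt s h3
  have ht : HasDerivAt (fun s : ℝ => t - s) (-1) s := by
    simpa using (hasDerivAt_id s).const_sub t
  have hγ : HasDerivAt (fun s : ℝ => (s, x + (t - s) • y)) ((1 : ℝ), -y) s := by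
    have := (hasDerivAt_id s).prodMk ((ht.smul_const y).const_add x)
    simpa using this
  have h5 := ((hU.differentiable (by norm_num) (s, x + (t - s) • y)).hasFDerivAt).comp_hasDerivAt
    s hγ
  have h6 := ((h1.differentiable (by norm_num) (s, x + (t - s) • y)).hasFDerivAt).comp_hasDerivAt
    s hγ
  have h7 := h6.clm_apply (hasDerivAt_const s ((1 : ℝ), y))
  have h8 := h4.unique (h5.add (ht.mul h7))
  rw [h8]
  have e1 : ((1 : ℝ), y) = (1, 0) + (0, y) := by simp
  have e2 : ((1 : ℝ), -y) = (1, 0) - (0, y) := by simp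
  have hs := fderiv_fderiv_symm (hU.of_le (by norm_num) : ContDiff ℝ 2 U) (s, x + (t - s) • y)
    (1, 0) (0, y)
  simp only [Function.comp_apply, map_zero, add_zero, e1, e2, map_add, map_sub,
    sub_apply, hs]
  ring

/-- Kirchhoff's formula in differential form. -/
theorem hasDerivAt_integral_kirchhoffIntegrand {U : ℝ × E3 → ℝ} (hU : ContDiff ℝ 3 U)
    {t s : ℝ} (hst : s < t) (x : E3) :
    HasDerivAt (fun s => ∫ y, kirchhoffIntegrand U t x (s, y) ∂sphereMeasure3)
      (∫ y, (t - s) * box3 U (s, x + (t - s) • y) ∂sphereMeasure3) s := by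
  have hr : t - s ≠ 0 := (sub_pos.2 hst).ne'
  have h1 : ContDiff ℝ 2 (fderiv ℝ U) := hU.fderiv_right (by norm_num)
  have h2 : ContDiff ℝ 1 (fderiv ℝ (fderiv ℝ U)) := h1.fderiv_right (by norm_num)
  refine (hasDerivAt_integral_of_contDiff sphereMeasure3 (L := 1)
    (ae_norm_eq_one_sphereMeasure3.mono fun y hy => hy.le)
    (contDiff_kirchhoffIntegrand hU t x) s).congr_deriv ?_
  simp only [fderiv_kirchhoffIntegrand hU]
  set r := t - s
  have hG : ContDiff ℝ 3 fun z : E3 => U (s, x + r • z) := hU.comp (by fun_prop)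
  have hG1 (y v : E3) := fderiv_comp_slice (hU.differentiable (by norm_num)) s r x y v
  have hG2 (y v w : E3) : fderiv ℝ (fderiv ℝ fun z : E3 => U (s, x + r • z)) y w v =
      r ^ 2 * fderiv ℝ (fderiv ℝ U) (s, x + r • y) (0, w) (0, v) := by
    rw [← fderiv_fderiv_apply_const (hG.of_le (by norm_num))]
    simp only [hG1]
    have hd : Differentiable ℝ fun p => r * fderiv ℝ U p (0, v) := by
      have := h1.differentiable (by norm_num)
      fun_prop
    rw [fderiv_comp_slice hd s r x y w, fderiv_const_mul]
    · rw [smul_apply, fderiv_fderiv_apply_const (hU.of_le (by norm_num))]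
      simp; ring
    · have := h1.differentiable (by norm_num)
      fun_prop
  have hS := integral_spherical_laplacian hG
  simp only [hG1, hG2] at hS
  have hc1 := h1.continuous
  have hc2 := h2.continuous
  have hc3 := continuous_box3 hU
  rw [← sub_eq_zero, ← integral_sub (integrable_sphereMeasure3 (by fun_prop))
    (integrable_sphereMeasure3 (by fun_prop))]
  have hS' := congrArg (fun z => r⁻¹ * z) hS
  simp only [mul_zero, ← integral_const_mul] at hS'
  refine Eq.trans ?_ hS'
  refine integral_congr_ae (Filter.Eventually.of_forall fun y => ?_)
  simp only [box3, ← Finset.mul_sum]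
  field_simp
  ring

theorem integral_kirchhoffIntegrand_self (U : ℝ × E3 → ℝ) (t : ℝ) (x : E3) :
    ∫ y, kirchhoffIntegrand U t x (t, y) ∂sphereMeasure3 =
      sphereMeasure3.real univ * U (t, x) := by
  simp [kirchhoffIntegrand]

/-- Small data stay small in a domain of dependence. -/
theorem abs_lt_of_cone_data {U : ℝ × E3 → ℝ} (hU : ContDiff ℝ 3 U)
    (hbox : ∀ p, |box3 U p| ≤ |U p| ^ 5) {T a : ℝ} (ha : 0 < a)
    (hTa : T ^ 2 * (2 * a) ^ 5 < a) {x₀ : E3}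
    (hdata : ∀ y ∈ closedBall x₀ T, ∀ τ ∈ Icc 0 T, ∀ ω : E3, ‖ω‖ = 1 →
      |U (0, y) + τ * fderiv ℝ U (0, y) (1, ω)| ≤ a)
    {t : ℝ} (ht : 0 ≤ t) {x : E3} (hx : ‖x - x₀‖ ≤ T - t) : |U (t, x)| < 2 * a := by
  by_contra! hcon
  let S : Set (ℝ × E3) := (Icc 0 T ×ˢ closedBall x₀ T) ∩
    ({p | ‖p.2 - x₀‖ ≤ T - p.1} ∩ {p | 2 * a ≤ |U p|})
  have hUc := hU.continuous
  have hS : IsCompact S := (isCompact_Icc.prod (isCompact_closedBall x₀ T)).inter_right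
    ((isClosed_le (by fun_prop) (by fun_prop)).inter (isClosed_le (by fun_prop) (by fun_prop)))
  have hmem {s : ℝ} {z : E3} (hs : 0 ≤ s) (hz : ‖z - x₀‖ ≤ T - s) (h : 2 * a ≤ |U (s, z)|) :
      (s, z) ∈ S :=
    ⟨⟨⟨hs, by linarith [norm_nonneg (z - x₀)]⟩, by
      rw [mem_closedBall, dist_eq_norm]; linarith⟩, hz, h⟩
  obtain ⟨⟨t, x⟩, ⟨⟨⟨ht, htT⟩, -⟩, hx, hcon⟩, hmin⟩ :=
    hS.exists_isMinOn ⟨(t, x), hmem ht hx hcon⟩ continuous_fst.continuousOn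
  simp only [mem_ofPred_eq] at ht htT hx hcon
  have hm := sphereMeasure3_real_univ_pos
  set m := sphereMeasure3.real univ
  have hball {s : ℝ} (hst : s ≤ t) {y : E3} (hy : ‖y‖ = 1) :
      ‖x + (t - s) • y - x₀‖ ≤ T - s := by
    calc ‖x + (t - s) • y - x₀‖ = ‖(x - x₀) + (t - s) • y‖ := by congr 1; abel
      _ ≤ ‖x - x₀‖ + ‖(t - s) • y‖ := norm_add_le _ _
      _ = ‖x - x₀‖ + (t - s) := by
        rw [norm_smul, hy, mul_one, Real.norm_of_nonneg (sub_nonneg.2 hst)]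
      _ ≤ T - s := by linarith
  have hderiv (s : ℝ) (hs : s ∈ Ico 0 t) :
      ‖∫ y, (t - s) * box3 U (s, x + (t - s) • y) ∂sphereMeasure3‖ ≤ T * (2 * a) ^ 5 * m := by
    refine norm_integral_le_of_norm_le_const ?_
    filter_upwards [ae_norm_eq_one_sphereMeasure3] with y hy
    have h1 : |U (s, x + (t - s) • y)| ≤ 2 * a := by
      by_contra! h
      have := hmin (hmem hs.1 (hball hs.2.le hy) h.le)
      simp only [mem_ofPred_eq] at this
      exact absurd hs.2 (not_lt.2 this)
    rw [norm_mul, Real.norm_of_nonneg (sub_nonneg.2 hs.2.le), Real.norm_eq_abs]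
    exact mul_le_mul (by linarith [hs.1]) ((hbox _).trans (by gcongr)) (abs_nonneg _)
      (ht.trans htT)
  have hcont : Continuous fun s => ∫ y, kirchhoffIntegrand U t x (s, y) ∂sphereMeasure3 :=
    continuous_iff_continuousAt.2 fun s => (hasDerivAt_integral_of_contDiff sphereMeasure3 (L := 1)
      (ae_norm_eq_one_sphereMeasure3.mono fun y hy => hy.le)
      (contDiff_kirchhoffIntegrand hU t x) s).continuousAt
  have hmv := norm_image_sub_le_of_norm_deriv_right_le_segment hcont.continuousOn
    (fun s hs => (hasDerivAt_integral_kirchhoffIntegrand hU hs.2 x).hasDerivWithinAt) hderiv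
    t ⟨ht, le_rfl⟩
  have h0 : ‖∫ y, kirchhoffIntegrand U t x (0, y) ∂sphereMeasure3‖ ≤ a * m := by
    refine norm_integral_le_of_norm_le_const ?_
    filter_upwards [ae_norm_eq_one_sphereMeasure3] with y hy
    refine hdata _ ?_ (t - 0) ⟨by linarith, by linarith⟩ y hy
    rw [mem_closedBall, dist_eq_norm]
    simpa using hball ht hy
  rw [integral_kirchhoffIntegrand_self] at hmv
  have h1 : m * |U (t, x)| ≤ a * m + T * (2 * a) ^ 5 * m * (t - 0) := by
    have := norm_le_norm_add_norm_sub' (m * U (t, x))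
      (∫ y, kirchhoffIntegrand U t x (0, y) ∂sphereMeasure3)
    rw [norm_mul, Real.norm_of_nonneg hm.le, Real.norm_eq_abs] at this
    linarith
  have h2 : T * (2 * a) ^ 5 * m * (t - 0) ≤ T * (2 * a) ^ 5 * m * T := by
    gcongr
    · have := ht.trans htT; positivity
    · linarith
  have h3 : m * (2 * a) ≤ m * |U (t, x)| := by gcongr
  have h4 : m * (T ^ 2 * (2 * a) ^ 5) < m * a := by gcongr
  linarith

theorem fderiv_slice {f : ℝ × E3 → ℝ} (hf : Differentiable ℝ f) (t : ℝ) (x v : E3) :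
    fderiv ℝ (fun z => f (t, z)) x v = fderiv ℝ f (t, x) (0, v) := by
  simpa using fderiv_comp_slice hf t 1 0 x v

theorem deriv_slice {f : ℝ × E3 → ℝ} (hf : Differentiable ℝ f) (t : ℝ) (x : E3) :
    deriv (fun s => f (s, x)) t = fderiv ℝ f (t, x) (1, 0) := by
  have h : HasDerivAt (fun s : ℝ => (s, x)) ((1 : ℝ), (0 : E3)) t :=
    (hasDerivAt_id t).prodMk (hasDerivAt_const t x)
  exact ((hf (t, x)).hasFDerivAt.comp_hasDerivAt t h).deriv

theorem norm_sq_fderiv_eq_sum (ℓ : E3 →L[ℝ] ℝ) : ‖ℓ‖ ^ 2 = ∑ i, ℓ (bas3 i) ^ 2 := by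
  have h (i : Fin 3) : ℓ (bas3 i) = ((InnerProductSpace.toDual ℝ E3).symm ℓ) i := by
    rw [← InnerProductSpace.toDual_symm_apply, EuclideanSpace.inner_single_right]
    simp
  rw [← (InnerProductSpace.toDual ℝ E3).symm.norm_map, EuclideanSpace.norm_sq_eq]
  simp [h]

/-- The energy density with potential `V`. -/
def energyDensity3 (U : ℝ × E3 → ℝ) (V : ℝ → ℝ) (p : ℝ × E3) : ℝ :=
  1 / 2 * fderiv ℝ U p (1, 0) ^ 2 + 1 / 2 * ∑ i, fderiv ℝ U p (0, bas3 i) ^ 2 + V (U p)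

theorem contDiff_energyDensity3 {U : ℝ × E3 → ℝ} (hU : ContDiff ℝ 2 U) {V : ℝ → ℝ}
    (hV : ContDiff ℝ 1 V) : ContDiff ℝ 1 (energyDensity3 U V) := by
  have h1 : ContDiff ℝ 1 (fderiv ℝ U) := hU.fderiv_right (by norm_num)
  have h2 : ContDiff ℝ 1 U := hU.of_le (by norm_num)
  unfold energyDensity3
  fun_prop

theorem fderiv_energyDensity3 {U : ℝ × E3 → ℝ} (hU : ContDiff ℝ 2 U) {V : ℝ → ℝ}
    (hV : ContDiff ℝ 1 V) (p v : ℝ × E3) :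
    fderiv ℝ (energyDensity3 U V) p v =
      fderiv ℝ U p (1, 0) * fderiv ℝ (fderiv ℝ U) p v (1, 0)
      + ∑ i, fderiv ℝ U p (0, bas3 i) * fderiv ℝ (fderiv ℝ U) p v (0, bas3 i)
      + deriv V (U p) * fderiv ℝ U p v := by
  have hd (w : ℝ × E3) : HasFDerivAt (fun q => fderiv ℝ U q w)
      (fderiv ℝ (fun q => fderiv ℝ U q w) p) p := by
    have h1 := (hU.fderiv_right (m := 1) (by norm_num)).differentiable (by norm_num)
    exact DifferentiableAt.hasFDerivAt (by fun_prop)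
  have hVU := (hV.differentiable (by norm_num) (U p)).hasDerivAt.comp_hasFDerivAt p
    (hU.differentiable (by norm_num) p).hasFDerivAt
  have h := ((((hd (1, 0)).pow 2).const_mul (1 / 2)).add
    ((HasFDerivAt.fun_sum (u := Finset.univ) fun i _ => (hd (0, bas3 i)).pow 2).const_mul
      (1 / 2))).add hVU
  have h' : fderiv ℝ (energyDensity3 U V) p = _ := h.fderiv
  rw [h']
  simp only [add_apply, smul_apply, fderiv_fderiv_apply_const hU, smul_eq_mul,
    Fin.sum_univ_three]
  norm_num
  ring

theorem setIntegral_fderiv_eq_zero {f : E3 → ℝ} (hf : ContDiff ℝ 1 f) {L : ℝ}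
    (hL : ∀ x, L ≤ ‖x‖ → f x = 0) (v : E3) :
    ∫ x in closedBall (0 : E3) L, fderiv ℝ f x v = 0 := by
  have hsupp : HasCompactSupport f := HasCompactSupport.intro (isCompact_closedBall (0 : E3) L)
    fun x hx => hL x (by simpa using (not_le.1 (by simpa using hx)).le)
  have hc := hf.continuous
  have hc' := hf.continuous_fderiv (by norm_num)
  rw [setIntegral_eq_integral_of_forall_compl_eq_zero]
  · have hi : Integrable fun x => fderiv ℝ f x v :=
      Continuous.integrable_of_hasCompactSupport (by fun_prop) (hsupp.fderiv_apply ℝ v)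
    have := integral_mul_fderiv_eq_neg_fderiv_mul_of_integrable (𝕜 := ℝ) (μ := volume)
      (f := fun _ : E3 => (1 : ℝ)) (g := f) (v := v) (by simp) (by simpa using hi)
      (by simpa using hc.integrable_of_hasCompactSupport hsupp)
      (fun x _ => by fun_prop) (fun x _ => hf.differentiable (by norm_num) x)
    simpa using this
  · intro x hx
    have hev : f =ᶠ[nhds x] fun _ => 0 := by
      have hopen : IsOpen {y : E3 | L < ‖y‖} := isOpen_lt continuous_const continuous_norm
      filter_upwards [hopen.mem_nhds (by simpa using hx)] with y hy using hL y (le_of_lt hy)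
    rw [hev.fderiv_eq]
    simp

theorem integrable_closedBall3 {f : E3 → ℝ} (hf : Continuous f) (L : ℝ) :
    Integrable f (volume.restrict (closedBall (0 : E3) L)) :=
  hf.continuousOn.integrableOn_compact (isCompact_closedBall _ _)

theorem hasDerivAt_weighted_energy {U W : ℝ × E3 → ℝ} (hU : ContDiff ℝ 2 U)
    (hW : ContDiff ℝ 1 W) {V : ℝ → ℝ} (hV : ContDiff ℝ 1 V) {L t : ℝ}
    (hL : ∀ x, L ≤ ‖x‖ → W (t, x) = 0) :
    HasDerivAt (fun s => ∫ x in closedBall (0 : E3) L, W (s, x) * energyDensity3 U V (s, x))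
      (∫ x in closedBall (0 : E3) L, (fderiv ℝ W (t, x) (1, 0) * energyDensity3 U V (t, x)
        - fderiv ℝ U (t, x) (1, 0) *
          ∑ i, fderiv ℝ W (t, x) (0, bas3 i) * fderiv ℝ U (t, x) (0, bas3 i)
        + W (t, x) * fderiv ℝ U (t, x) (1, 0) * (box3 U (t, x) + deriv V (U (t, x))))) t := by
  have hE := contDiff_energyDensity3 hU hV
  have hU1 : ContDiff ℝ 1 (fderiv ℝ U) := hU.fderiv_right (by norm_num)
  have : IsFiniteMeasure (volume.restrict (closedBall (0 : E3) L)) :=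
    ⟨by simpa using (isCompact_closedBall (0 : E3) L).measure_lt_top (μ := volume)⟩
  refine (hasDerivAt_integral_of_contDiff (volume.restrict (closedBall (0 : E3) L)) (L := L)
    ((ae_restrict_mem measurableSet_closedBall).mono fun x hx => by simpa using hx)
    (hW.mul hE) t).congr_deriv ?_
  let f (i : Fin 3) (p : ℝ × E3) : ℝ :=
    W p * (fderiv ℝ U p (1, 0) * fderiv ℝ U p (0, bas3 i))
  have hf (i : Fin 3) : ContDiff ℝ 1 (f i) := by
    change ContDiff ℝ 1 fun p => W p * (fderiv ℝ U p (1, 0) * fderiv ℝ U p (0, bas3 i))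
    fun_prop
  have hdiv (i : Fin 3) : ∫ x in closedBall (0 : E3) L, fderiv ℝ (f i) (t, x) (0, bas3 i) = 0 := by
    simp only [← fderiv_slice ((hf i).differentiable (by norm_num))]
    exact setIntegral_fderiv_eq_zero ((hf i).comp (by fun_prop))
      (fun x hx => by simp [f, hL x hx]) _
  have hfc (i : Fin 3) := (hf i).continuous_fderiv (by norm_num)
  have hsum : ∫ x in closedBall (0 : E3) L, ∑ i, fderiv ℝ (f i) (t, x) (0, bas3 i) = 0 := by
    rw [integral_finsetSum]
    · simp [hdiv]
    · intro i _
      have := hfc i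
      exact integrable_closedBall3 (by fun_prop) L
  have hWc := hW.continuous_fderiv (by norm_num)
  have hWc' := hW.continuous
  have hEc := hE.continuous
  have hUc := hU1.continuous
  have hUc' := hU.continuous
  have hUc2 := hU1.continuous_fderiv (by norm_num)
  have hVc := hV.continuous_deriv (by norm_num)
  have hbc : Continuous (box3 U) := by unfold box3; fun_prop
  have hWEc := (hW.mul hE).continuous_fderiv (by norm_num)
  refine sub_eq_zero.1 (Eq.trans ?_ hsum)
  rw [← integral_sub (integrable_closedBall3 (by fun_prop) L)
      (integrable_closedBall3 (by fun_prop) L)]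
  refine integral_congr_ae (Filter.Eventually.of_forall fun x => ?_)
  have hfd (i : Fin 3) : fderiv ℝ (f i) (t, x) (0, bas3 i) =
      W (t, x) * (fderiv ℝ U (t, x) (1, 0) *
        fderiv ℝ (fderiv ℝ U) (t, x) (0, bas3 i) (0, bas3 i)
        + fderiv ℝ U (t, x) (0, bas3 i) * fderiv ℝ (fderiv ℝ U) (t, x) (1, 0) (0, bas3 i))
      + fderiv ℝ U (t, x) (1, 0) * fderiv ℝ U (t, x) (0, bas3 i) *
        fderiv ℝ W (t, x) (0, bas3 i) := by
    have hd (w : ℝ × E3) : HasFDerivAt (fun q => fderiv ℝ U q w)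
        (fderiv ℝ (fun q => fderiv ℝ U q w) (t, x)) (t, x) := by
      have h1 := hU1.differentiable (by norm_num)
      exact DifferentiableAt.hasFDerivAt (by fun_prop)
    have h := (hW.differentiable (by norm_num) (t, x)).hasFDerivAt.mul
      ((hd (1, 0)).mul (hd (0, bas3 i)))
    have h' : fderiv ℝ (f i) (t, x) = _ := h.fderiv
    rw [h', fderiv_fderiv_symm hU (t, x) (1, 0) (0, bas3 i)]
    simp [fderiv_fderiv_apply_const hU]
    ring
  have hWE : fderiv ℝ (fun p => W p * energyDensity3 U V p) (t, x) (1, 0) =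
      W (t, x) * fderiv ℝ (energyDensity3 U V) (t, x) (1, 0)
      + energyDensity3 U V (t, x) * fderiv ℝ W (t, x) (1, 0) := by
    rw [fderiv_fun_mul (hW.differentiable (by norm_num) _) (hE.differentiable (by norm_num) _)]
    simp
  simp only [hfd]
  change fderiv ℝ (fun p => W p * energyDensity3 U V p) (t, x) (1, 0) - _ = _
  rw [hWE, fderiv_energyDensity3 hU hV]
  simp only [box3, Fin.sum_univ_three]
  ring

/-- The Japanese bracket `√(1 + |x|²)`. -/
def japanese3 (x : E3) : ℝ := √(1 + ‖x‖ ^ 2)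

theorem norm_le_japanese3 (x : E3) : ‖x‖ ≤ japanese3 x :=
  Real.le_sqrt_of_sq_le (by linarith)

theorem japanese3_pos (x : E3) : 0 < japanese3 x := Real.sqrt_pos.2 (by positivity)

theorem japanese3_le (x : E3) : japanese3 x ≤ 1 + ‖x‖ :=
  Real.sqrt_le_iff.2 ⟨by positivity, by nlinarith [norm_nonneg x]⟩

/-- A smooth cutoff to the region `c t + b ⟨x⟩ ≤ A`. -/
def coneWeight (A c b : ℝ) (p : ℝ × E3) : ℝ :=
  Real.smoothTransition (A - c * p.1 - b * japanese3 p.2)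

theorem contDiff_coneWeight (A c b : ℝ) : ContDiff ℝ 1 (coneWeight A c b) := by
  have h : ContDiff ℝ 1 japanese3 := by
    unfold japanese3
    exact (contDiff_const.add (contDiff_norm_sq ℝ)).sqrt fun x => by positivity
  have h' : ContDiff ℝ 1 fun p : ℝ × E3 => A - c * p.1 - b * japanese3 p.2 := by fun_prop
  exact Real.smoothTransition.contDiff.comp h'

theorem fderiv_coneWeight (A c b : ℝ) (p v : ℝ × E3) :
    fderiv ℝ (coneWeight A c b) p v =
      -deriv Real.smoothTransition (A - c * p.1 - b * japanese3 p.2) *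
        (c * v.1 + b * (inner ℝ p.2 v.2 / japanese3 p.2)) := by
  have hs : HasFDerivAt (fun x : E3 => 1 + ‖x‖ ^ 2) (2 • (innerSL ℝ p.2)) p.2 :=
    (hasStrictFDerivAt_norm_sq p.2).hasFDerivAt.const_add 1
  have hj : HasFDerivAt japanese3 _ p.2 := hs.sqrt (by positivity)
  have hj' := hj.comp p (hasFDerivAt_snd (𝕜 := ℝ) (E := ℝ) (F := E3))
  have hl := (((hasFDerivAt_fst (𝕜 := ℝ) (E := ℝ) (F := E3) (p := p)).const_mul c).const_sub A).sub
    (hj'.const_mul b)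
  have hη := ((Real.smoothTransition.contDiff (n := 1)).differentiable (by norm_num)
    (A - c * p.1 - b * japanese3 p.2)).hasDerivAt
  have h := hη.comp_hasFDerivAt p hl
  have h' : fderiv ℝ (coneWeight A c b) p = _ := h.fderiv
  rw [h']
  have := (japanese3_pos p.2).ne'
  have e : √(1 + ‖p.2‖ ^ 2) = japanese3 p.2 := rfl
  simp [e]
  field_simp
  ring

theorem coneWeight_eq_zero {A c b : ℝ} {p : ℝ × E3} (h : A ≤ c * p.1 + b * japanese3 p.2) :
    coneWeight A c b p = 0 :=
  Real.smoothTransition.zero_of_nonpos (by linarith)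

theorem coneWeight_eq_one {A c b : ℝ} {p : ℝ × E3} (h : c * p.1 + b * japanese3 p.2 ≤ A - 1) :
    coneWeight A c b p = 1 :=
  Real.smoothTransition.one_of_one_le (by linarith)

theorem abs_mul_sum_le {n v : Fin 3 → ℝ} (hn : ∑ i, n i ^ 2 ≤ 1) (w : ℝ) :
    |w * ∑ i, n i * v i| ≤ 1 / 2 * w ^ 2 + 1 / 2 * ∑ i, v i ^ 2 := by
  simp only [Fin.sum_univ_three] at *
  have h := mul_le_mul_of_nonneg_left hn (sq_nonneg w)
  rw [abs_le]
  constructor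
  · nlinarith [sq_nonneg (w * n 0 + v 0), sq_nonneg (w * n 1 + v 1), sq_nonneg (w * n 2 + v 2)]
  · nlinarith [sq_nonneg (w * n 0 - v 0), sq_nonneg (w * n 1 - v 1), sq_nonneg (w * n 2 - v 2)]

theorem sum_sq_div_japanese3_le (x : E3) : ∑ i, (x i / japanese3 x) ^ 2 ≤ 1 := by
  have h := japanese3_pos x
  have h1 : japanese3 x ^ 2 = 1 + ‖x‖ ^ 2 := Real.sq_sqrt (by positivity)
  simp only [Fin.sum_univ_three, div_pow, ← add_div, ← norm_sq_eq_E3]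
  rw [div_le_one (by positivity), h1]
  linarith

theorem fderiv_coneWeight_time (A c b : ℝ) (p : ℝ × E3) :
    fderiv ℝ (coneWeight A c b) p (1, 0) =
      -(deriv Real.smoothTransition (A - c * p.1 - b * japanese3 p.2) * c) := by
  rw [fderiv_coneWeight]
  simp

theorem fderiv_coneWeight_space (A c b : ℝ) (p : ℝ × E3) (i : Fin 3) :
    fderiv ℝ (coneWeight A c b) p (0, bas3 i) =
      -(deriv Real.smoothTransition (A - c * p.1 - b * japanese3 p.2) * b) *
        (p.2 i / japanese3 p.2) := by
  rw [fderiv_coneWeight]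
  simp [bas3, EuclideanSpace.inner_single_right]
  ring

theorem deriv_smoothTransition_nonneg (x : ℝ) : 0 ≤ deriv Real.smoothTransition x :=
  Real.smoothTransition.monotone.deriv_nonneg

theorem exists_deriv_smoothTransition_le :
    ∃ C, 0 ≤ C ∧ ∀ x, deriv Real.smoothTransition x ≤ C := by
  have hc := (Real.smoothTransition.contDiff (n := 1)).continuous_deriv (by norm_num)
  obtain ⟨C, hC⟩ := isCompact_Icc.exists_bound_of_continuousOn (s := Icc (0 : ℝ) 1) hc.continuousOn
  refine ⟨C, (norm_nonneg _).trans (hC 0 (by simp)), fun x => ?_⟩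
  by_cases hx : x ∈ Icc (0 : ℝ) 1
  · exact (le_abs_self _).trans (hC x hx)
  · have hC0 : 0 ≤ C := (norm_nonneg _).trans (hC 0 (by simp))
    suffices h : deriv Real.smoothTransition x = 0 by rwa [h]
    rcases lt_or_ge x 0 with h | h
    · have : Real.smoothTransition =ᶠ[nhds x] fun _ => 0 := by
        filter_upwards [Iio_mem_nhds h] with y hy
        exact Real.smoothTransition.zero_of_nonpos (le_of_lt hy)
      rw [this.deriv_eq, deriv_const]
    · have h1 : 1 < x := not_le.1 fun h1 => hx ⟨h, h1⟩
      have : Real.smoothTransition =ᶠ[nhds x] fun _ => 1 := by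
        filter_upwards [Ioi_mem_nhds h1] with y hy
        exact Real.smoothTransition.one_of_one_le (le_of_lt hy)
      rw [this.deriv_eq, deriv_const]

/-- Solutions with data vanishing at infinity are bounded on time slabs. -/
theorem exists_bound_of_tendsto_cocompact {U : ℝ × E3 → ℝ} (hU : ContDiff ℝ 3 U)
    (hbox : ∀ p, |box3 U p| ≤ |U p| ^ 5)
    (h0 : Filter.Tendsto (fun x => U (0, x)) (Filter.cocompact E3) (nhds 0))
    (h1 : Filter.Tendsto (fun x => fderiv ℝ U (0, x)) (Filter.cocompact E3) (nhds 0))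
    {T : ℝ} (hT : 0 ≤ T) : ∃ M, ∀ t ∈ Icc 0 T, ∀ x, |U (t, x)| ≤ M := by
  obtain ⟨a, ha, hTa⟩ : ∃ a : ℝ, 0 < a ∧ T ^ 2 * (2 * a) ^ 5 < a := by
    refine ⟨1 / (4 * (1 + T)), by positivity, ?_⟩
    rw [mul_one_div, div_pow, ← mul_div_assoc, div_lt_div_iff₀ (by positivity) (by positivity)]
    have h2 : T ^ 2 ≤ (1 + T) ^ 2 := by nlinarith
    have h3 : 1 ≤ (1 + T) ^ 2 := by nlinarith
    have h4 : (1 + T) ^ 2 * (1 + T) ≤ (1 + T) ^ 4 * (1 + T) := by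
      have : (1 + T) ^ 2 ≤ (1 + T) ^ 4 := by nlinarith
      gcongr
    have h5 : T ^ 2 * (1 + T) ≤ (1 + T) ^ 2 * (1 + T) := by gcongr
    have h6 : 0 < (1 + T) ^ 4 * (1 + T) := by positivity
    nlinarith
  have e0 := (Metric.tendsto_nhds.1 h0) (a / 2) (by positivity)
  have e1 := (Metric.tendsto_nhds.1 h1) (a / (2 * (1 + T))) (by positivity)
  obtain ⟨ρ, hρ⟩ := closedBall_compl_subset_of_mem_cocompact (e0.and e1) (0 : E3)
  have hU' := hU.continuous
  have hcpt : IsCompact (Icc 0 T ×ˢ closedBall (0 : E3) (ρ + T)) :=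
    isCompact_Icc.prod (isCompact_closedBall _ _)
  obtain ⟨M, hM⟩ := hcpt.exists_bound_of_continuousOn hU'.continuousOn
  refine ⟨max M (2 * a), fun t ht x => ?_⟩
  by_cases hx : ‖x‖ ≤ ρ + T
  · exact (hM (t, x) ⟨ht, by simpa using hx⟩).trans (le_max_left _ _)
  · refine le_trans (le_of_lt ?_) (le_max_right _ _)
    refine abs_lt_of_cone_data hU hbox (T := T) ha hTa (x₀ := x) ?_ ht.1 (by simpa using ht.2)
    intro y hy τ hτ ω hω
    have hy' : y ∈ (closedBall (0 : E3) ρ)ᶜ := by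
      simp only [mem_compl_iff, mem_closedBall, dist_zero_right, not_le] at hx ⊢
      rw [mem_closedBall, dist_comm, dist_eq_norm] at hy
      linarith [norm_le_norm_add_norm_sub' x y]
    obtain ⟨hy0, hy1⟩ := hρ hy'
    rw [dist_zero_right, Real.norm_eq_abs] at hy0
    rw [dist_zero_right] at hy1
    have hω' : |fderiv ℝ U (0, y) (1, ω)| ≤ a / (2 * (1 + T)) := by
      refine ((fderiv ℝ U (0, y)).le_opNorm _).trans ?_
      simpa [Prod.norm_def, hω] using hy1.le
    calc |U (0, y) + τ * fderiv ℝ U (0, y) (1, ω)|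
        ≤ |U (0, y)| + |τ * fderiv ℝ U (0, y) (1, ω)| := abs_add_le _ _
      _ ≤ a / 2 + (1 + T) * (a / (2 * (1 + T))) := by
        rw [abs_mul, abs_of_nonneg hτ.1]
        gcongr
        linarith [hτ.2]
      _ = a := by field_simp; ring

theorem energyDensity3_nonneg (U : ℝ × E3 → ℝ) {V : ℝ → ℝ} (hV : ∀ z, 0 ≤ V z) (p : ℝ × E3) :
    0 ≤ energyDensity3 U V p := by
  have := hV (U p)
  unfold energyDensity3
  positivity

theorem abs_mul_sum_japanese3_le (U : ℝ × E3 → ℝ) {V : ℝ → ℝ} (hV : ∀ z, 0 ≤ V z) (p : ℝ × E3) :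
    |fderiv ℝ U p (1, 0) * ∑ i, p.2 i / japanese3 p.2 * fderiv ℝ U p (0, bas3 i)| ≤
      energyDensity3 U V p := by
  refine (abs_mul_sum_le (sum_sq_div_japanese3_le p.2) _).trans ?_
  have := hV (U p)
  unfold energyDensity3
  linarith

/-- The free Klein-Gordon energy on balls is bounded, by Grönwall's inequality and finite speed of
propagation. -/
theorem exists_setIntegral_energyDensity3_le {ε : ℝ} (hε : |ε| = 1) {U : ℝ × E3 → ℝ}
    (hU : ContDiff ℝ 3 U) (hbox : ∀ p, box3 U p = -ε * U p ^ 5) {T M : ℝ}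
    (hUM : ∀ t ∈ Icc 0 T, ∀ x, |U (t, x)| ≤ M)
    (hInt : Integrable fun x => energyDensity3 U (fun z => z ^ 2 / 2) (0, x)) :
    ∃ C, 0 ≤ C ∧ ∀ t ∈ Icc 0 T, ∀ r, 0 ≤ r →
      ∫ x in closedBall (0 : E3) r, energyDensity3 U (fun z => z ^ 2 / 2) (t, x) ≤ C := by
  set e := energyDensity3 U (fun z => z ^ 2 / 2) with he
  have he0 : ∀ p, 0 ≤ e p := energyDensity3_nonneg U (fun z => by positivity)
  have hV : ContDiff ℝ 1 (fun z : ℝ => z ^ 2 / 2) := by fun_prop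
  have hU2 : ContDiff ℝ 2 U := hU.of_le (by norm_num)
  have hec : Continuous e := (contDiff_energyDensity3 hU2 hV).continuous
  have hUc := hU.continuous
  have hU1 := hU.continuous_fderiv (by norm_num)
  have hbc := continuous_box3 hU
  let K := 1 + M ^ 4
  have hI : 0 ≤ ∫ x, e (0, x) := integral_nonneg fun x => he0 _
  refine ⟨Real.exp (K * T) * ∫ x, e (0, x), by positivity, fun t ht r hr => ?_⟩
  let L := r + T + 2
  let W := coneWeight L 1 1
  have hW : ContDiff ℝ 1 W := contDiff_coneWeight L 1 1
  have hWc : Continuous W := hW.continuous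
  have hWc' := hW.continuous_fderiv (by norm_num)
  have hW0 : ∀ p, 0 ≤ W p := fun p => Real.smoothTransition.nonneg _
  have hW1 : ∀ p, W p ≤ 1 := fun p => Real.smoothTransition.le_one _
  let F (s : ℝ) := ∫ x in closedBall (0 : E3) L, W (s, x) * e (s, x)
  let F' (s : ℝ) := ∫ x in closedBall (0 : E3) L, (fderiv ℝ W (s, x) (1, 0) * e (s, x)
        - fderiv ℝ U (s, x) (1, 0) *
          ∑ i, fderiv ℝ W (s, x) (0, bas3 i) * fderiv ℝ U (s, x) (0, bas3 i)
        + W (s, x) * fderiv ℝ U (s, x) (1, 0) * (box3 U (s, x) + U (s, x)))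
  have hF : ∀ s, 0 ≤ s → HasDerivAt F (F' s) s := by
    intro s hs
    have hd (z : ℝ) : deriv (fun z : ℝ => z ^ 2 / 2) z = z := by simp
    have := hasDerivAt_weighted_energy hU2 hW hV (L := L) (t := s) fun x hx => by
      refine coneWeight_eq_zero ?_
      dsimp only
      linarith [norm_le_japanese3 x]
    simpa only [hd] using this
  have hFK : ∀ s ∈ Icc 0 T, F' s ≤ K * F s := by
    intro s hs
    rw [← integral_const_mul]
    refine integral_mono (integrable_closedBall3 (by fun_prop) L)
      (integrable_closedBall3 (by fun_prop) L) fun x => ?_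
    dsimp only
    have hη := deriv_smoothTransition_nonneg (L - 1 * s - 1 * japanese3 x)
    set η := deriv Real.smoothTransition (L - 1 * s - 1 * japanese3 x)
    have h1 : fderiv ℝ W (s, x) (1, 0) = -η := by
      rw [fderiv_coneWeight_time, mul_one]
    have h2 (i : Fin 3) : fderiv ℝ W (s, x) (0, bas3 i) = -η * (x i / japanese3 x) := by
      rw [fderiv_coneWeight_space, mul_one]
    have h3 : fderiv ℝ W (s, x) (1, 0) * e (s, x) - fderiv ℝ U (s, x) (1, 0) *
        ∑ i, fderiv ℝ W (s, x) (0, bas3 i) * fderiv ℝ U (s, x) (0, bas3 i) ≤ 0 := by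
      have := (le_abs_self _).trans (abs_mul_sum_japanese3_le U (V := fun z => z ^ 2 / 2)
        (fun z => by positivity) (s, x))
      have h4 := mul_nonneg hη (sub_nonneg.2 this)
      simp only [h1, h2, mul_assoc, ← Finset.mul_sum]
      simp only [← he] at h4
      linarith
    have h4 : fderiv ℝ U (s, x) (1, 0) * (box3 U (s, x) + U (s, x)) ≤ K * e (s, x) := by
      set v := fderiv ℝ U (s, x) (1, 0) with hv
      set z := U (s, x) with hz
      have h5 : |box3 U (s, x) + z| ≤ K * |z| := by
        refine (abs_add_le _ _).trans ?_
        rw [hbox, abs_mul, abs_neg, hε, abs_pow, ← hz]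
        have : |z| ^ 4 ≤ M ^ 4 := by
          gcongr
          exact hUM s hs x
        have := mul_le_mul_of_nonneg_right this (abs_nonneg z)
        simp only [K]
        linarith
      have h6 : |v| * |z| ≤ e (s, x) := by
        have h7 : 0 ≤ ∑ i, fderiv ℝ U (s, x) (0, bas3 i) ^ 2 := by positivity
        simp only [he, energyDensity3, ← hv, ← hz]
        nlinarith [sq_nonneg (|v| - |z|), sq_abs v, sq_abs z]
      calc v * (box3 U (s, x) + z) ≤ |v| * |box3 U (s, x) + z| := by
            rw [← abs_mul]; exact le_abs_self _
        _ ≤ |v| * (K * |z|) := by gcongr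
        _ = K * (|v| * |z|) := by ring
        _ ≤ K * e (s, x) := by gcongr
    have h5 := mul_le_mul_of_nonneg_left h4 (hW0 (s, x))
    linarith
  have hanti : AntitoneOn (fun s => Real.exp (-(K * s)) * F s) (Icc 0 T) := by
    have hd : ∀ s, 0 ≤ s → HasDerivAt (fun s => Real.exp (-(K * s)) * F s)
        (Real.exp (-(K * s)) * -(K * 1) * F s + Real.exp (-(K * s)) * F' s) s := fun s hs =>
      (((hasDerivAt_id s).const_mul K).neg.exp).mul (hF s hs)
    refine antitoneOn_of_deriv_nonpos (convex_Icc _ _)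
      (fun s hs => (hd s hs.1).continuousAt.continuousWithinAt)
      (fun s hs => (hd s (interior_subset hs).1).differentiableAt.differentiableWithinAt) ?_
    intro s hs
    have hs' := interior_subset hs
    rw [(hd s hs'.1).deriv]
    have := mul_nonneg (Real.exp_pos (-(K * s))).le (sub_nonneg.2 (hFK s hs'))
    linarith
  have hF0 : F 0 ≤ ∫ x, e (0, x) := by
    refine (integral_mono (integrable_closedBall3 (by fun_prop) L) hInt.integrableOn
      fun x => ?_).trans (setIntegral_le_integral hInt (Filter.Eventually.of_forall fun x => he0 _))
    exact mul_le_of_le_one_left (he0 _) (hW1 _)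
  have hFt : F t ≤ Real.exp (K * T) * ∫ x, e (0, x) := by
    have h1 := hanti ⟨le_rfl, ht.1.trans ht.2⟩ ht ht.1
    have h2 : F t = Real.exp (K * t) * (Real.exp (-(K * t)) * F t) := by
      rw [← mul_assoc, ← Real.exp_add]
      simp
    have hK : 0 ≤ K := by positivity
    rw [h2]
    simp only [mul_zero, neg_zero, Real.exp_zero, one_mul] at h1
    calc _ ≤ Real.exp (K * t) * ∫ x, e (0, x) := by
          gcongr
          exact h1.trans hF0
      _ ≤ _ := by
          gcongr
          exact ht.2
  refine le_trans ?_ hFt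
  calc ∫ x in closedBall (0 : E3) r, e (t, x)
      = ∫ x in closedBall (0 : E3) r, W (t, x) * e (t, x) := by
        refine setIntegral_congr_fun measurableSet_closedBall fun x hx => ?_
        have : W (t, x) = 1 := by
          refine coneWeight_eq_one ?_
          rw [mem_closedBall, dist_zero_right] at hx
          dsimp only [L]
          linarith [japanese3_le x, ht.2]
        simp [this]
    _ ≤ F t := by
        refine setIntegral_mono_set (integrable_closedBall3 (by fun_prop) L)
          (Filter.Eventually.of_forall fun x => mul_nonneg (hW0 _) (he0 _)) ?_
        refine (closedBall_subset_closedBall ?_).eventuallyLE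
        linarith [ht.1.trans ht.2]

theorem tendsto_setIntegral_coneWeight {f : E3 → ℝ} (hf : Integrable f) (t : ℝ) :
    Filter.Tendsto (fun R : ℝ => ∫ x in closedBall (0 : E3) (2 * R),
      coneWeight 2 0 (1 / R) (t, x) * f x) Filter.atTop (nhds (∫ x, f x)) := by
  have h : Filter.Tendsto (fun R : ℝ => ∫ x, coneWeight 2 0 (1 / R) (t, x) * f x) Filter.atTop
      (nhds (∫ x, f x)) := by
    refine tendsto_integral_filter_of_dominated_convergence (fun x => ‖f x‖)
      (Filter.Eventually.of_forall fun R => ?_)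
      (Filter.Eventually.of_forall fun R => Filter.Eventually.of_forall fun x => ?_)
      hf.norm (Filter.Eventually.of_forall fun x => ?_)
    · have := (contDiff_coneWeight 2 0 (1 / R)).continuous
      exact Continuous.aestronglyMeasurable (by fun_prop) |>.mul hf.aestronglyMeasurable
    · rw [coneWeight, norm_mul, Real.norm_of_nonneg (Real.smoothTransition.nonneg _)]
      exact mul_le_of_le_one_left (norm_nonneg _) (Real.smoothTransition.le_one _)
    · have h1 : Filter.Tendsto (fun R : ℝ => 2 - 0 * t - 1 / R * japanese3 x) Filter.atTop
          (nhds (2 - 0 * t - 0 * japanese3 x)) :=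
        ((tendsto_const_nhds.div_atTop Filter.tendsto_id).mul_const _).const_sub _
      have h2 := (Real.smoothTransition.continuous.tendsto _).comp h1
      rw [Real.smoothTransition.one_of_one_le (by norm_num)] at h2
      simpa [coneWeight] using h2.mul_const (f x)
  refine h.congr' ?_
  filter_upwards [Filter.eventually_gt_atTop 0] with R hR
  refine (setIntegral_eq_integral_of_forall_compl_eq_zero fun x hx => ?_).symm
  rw [coneWeight_eq_zero, zero_mul]
  have h1 : 2 * R ≤ japanese3 x := (by simpa using hx : 2 * R < ‖x‖).le.trans (norm_le_japanese3 x)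
  have : 2 ≤ japanese3 x / R := (le_div_iff₀ hR).2 h1
  simpa [div_eq_inv_mul] using this

theorem integral_energyDensity3_eq {ε : ℝ} (hε : |ε| = 1) {U : ℝ × E3 → ℝ}
    (hU : ContDiff ℝ 3 U) (hbox : ∀ p, box3 U p = -ε * U p ^ 5)
    (h0 : Filter.Tendsto (fun x => U (0, x)) (Filter.cocompact E3) (nhds 0))
    (h1 : Filter.Tendsto (fun x => fderiv ℝ U (0, x)) (Filter.cocompact E3) (nhds 0))
    (hInt : Integrable fun x => energyDensity3 U (fun z => z ^ 2 / 2) (0, x))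
    {T : ℝ} (hT : 0 ≤ T)
    (hInt0 : Integrable fun x => energyDensity3 U (fun z => ε / 6 * z ^ 6) (0, x))
    (hIntT : Integrable fun x => energyDensity3 U (fun z => ε / 6 * z ^ 6) (T, x)) :
    ∫ x, energyDensity3 U (fun z => ε / 6 * z ^ 6) (T, x) =
      ∫ x, energyDensity3 U (fun z => ε / 6 * z ^ 6) (0, x) := by
  obtain ⟨M, hUM⟩ := exists_bound_of_tendsto_cocompact hU
    (fun p => by rw [hbox, abs_mul, abs_neg, hε, abs_pow, one_mul]) h0 h1 hT
  obtain ⟨C, hC, hEC⟩ := exists_setIntegral_energyDensity3_le hε hU hbox hUM hInt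
  obtain ⟨D, hD, hηD⟩ := exists_deriv_smoothTransition_le
  have hU2 : ContDiff ℝ 2 U := hU.of_le (by norm_num)
  have hV : ContDiff ℝ 1 (fun z : ℝ => ε / 6 * z ^ 6) := by fun_prop
  have hec : Continuous (energyDensity3 U (fun z => z ^ 2 / 2)) :=
    (contDiff_energyDensity3 hU2 (by fun_prop)).continuous
  have hU1 := hU.continuous_fderiv (by norm_num)
  let G (R t : ℝ) := ∫ x in closedBall (0 : E3) (2 * R),
    coneWeight 2 0 (1 / R) (t, x) * energyDensity3 U (fun z => ε / 6 * z ^ 6) (t, x)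
  have hG : ∀ R, 0 < R → ‖G R T - G R 0‖ ≤ D * (1 / R) * C * (T - 0) := by
    intro R hR
    have hW := contDiff_coneWeight 2 0 (1 / R)
    have hWc := hW.continuous_fderiv (by norm_num)
    have hd (t : ℝ) := hasDerivAt_weighted_energy hU2 hW hV (L := 2 * R) (t := t) fun x hx => by
      refine coneWeight_eq_zero ?_
      have h1 : 2 * R ≤ japanese3 x := hx.trans (norm_le_japanese3 x)
      have : 2 ≤ japanese3 x / R := (le_div_iff₀ hR).2 h1
      simpa [div_eq_inv_mul] using this
    refine norm_image_sub_le_of_norm_deriv_le_segment'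
      (fun t _ => (hd t).hasDerivWithinAt) (fun t ht => ?_) T ⟨hT, le_rfl⟩
    have ht' : t ∈ Icc 0 T := ⟨ht.1, ht.2.le⟩
    refine le_trans ?_ (mul_le_mul_of_nonneg_left (hEC t ht' (2 * R) (by positivity))
      (by positivity : 0 ≤ D * (1 / R)))
    rw [← integral_const_mul]
    refine norm_integral_le_of_norm_le (integrable_closedBall3 (by fun_prop) _)
      (Filter.Eventually.of_forall fun x => ?_)
    have hη := deriv_smoothTransition_nonneg (2 - 0 * t - 1 / R * japanese3 x)
    have hηD' := hηD (2 - 0 * t - 1 / R * japanese3 x)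
    have hz (z : ℝ) : deriv (fun z : ℝ => ε / 6 * z ^ 6) z = ε * z ^ 5 := by
      simp
      ring
    simp only [fderiv_coneWeight_time, fderiv_coneWeight_space, hz, hbox, mul_assoc,
      ← Finset.mul_sum]
    set η := deriv Real.smoothTransition (2 - 0 * t - 1 / R * japanese3 x)
    set S := ∑ i, x i / japanese3 x * fderiv ℝ U (t, x) (0, bas3 i) with hS
    have hb := abs_mul_sum_japanese3_le U (V := fun z => z ^ 2 / 2) (fun z => by positivity) (t, x)
    calc _ = ‖η * (1 / R) * (fderiv ℝ U (t, x) (1, 0) * S)‖ := by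
          congr 1
          simp only [hS, mul_assoc]
          ring
      _ = η * (1 / R) * |fderiv ℝ U (t, x) (1, 0) * S| := by
          rw [norm_mul, Real.norm_of_nonneg (by positivity), Real.norm_eq_abs]
      _ ≤ D * (1 / R) * energyDensity3 U (fun z => z ^ 2 / 2) (t, x) := by gcongr
      _ = _ := by ring
  have hlim := (tendsto_setIntegral_coneWeight hIntT T).sub (tendsto_setIntegral_coneWeight hInt0 0)
  have hlim0 : Filter.Tendsto (fun R => G R T - G R 0) Filter.atTop (nhds 0) := by
    refine squeeze_zero_norm' ((Filter.eventually_gt_atTop 0).mono hG) ?_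
    have h : Filter.Tendsto (fun R : ℝ => 1 / R) Filter.atTop (nhds 0) :=
      tendsto_const_nhds.div_atTop Filter.tendsto_id
    simpa using ((h.const_mul D).mul_const C).mul_const (T - 0)
  exact sub_eq_zero.1 (tendsto_nhds_unique hlim hlim0)

theorem SchwartzMap.integrable_pow3 (g : 𝓢(E3, ℝ)) (n : ℕ) (hn : n ≠ 0) :
    Integrable fun x => ‖g x‖ ^ n :=
  (g.memLp n volume).integrable_norm_pow hn

theorem SchwartzMap.integrable_norm_fderiv_sq (g : 𝓢(E3, ℝ)) :
    Integrable fun x => ‖fderiv ℝ g x‖ ^ 2 := by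
  simpa using ((SchwartzMap.fderivCLM ℝ E3 ℝ g).memLp 2 volume).integrable_norm_pow (by norm_num)

namespace IsNLWSolution

variable {ε : ℝ} {u : ℝ → E3 → ℝ}

theorem contDiff_nat (hu : IsNLWSolution ε u) (n : ℕ) :
    ContDiff ℝ n (fun p : ℝ × E3 => u p.1 p.2) :=
  contDiff_infty.1 hu.smooth n

theorem differentiable (hu : IsNLWSolution ε u) :
    Differentiable ℝ (fun p : ℝ × E3 => u p.1 p.2) :=
  hu.smooth.differentiable (by norm_num)

theorem dt_eq (hu : IsNLWSolution ε u) (t : ℝ) (x : E3) :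
    dt u t x = fderiv ℝ (fun p : ℝ × E3 => u p.1 p.2) (t, x) (1, 0) :=
  deriv_slice hu.differentiable t x

theorem fderiv_eq (hu : IsNLWSolution ε u) (t : ℝ) (x v : E3) :
    fderiv ℝ (u t) x v = fderiv ℝ (fun p : ℝ × E3 => u p.1 p.2) (t, x) (0, v) :=
  fderiv_slice hu.differentiable t x v

theorem box3_eq (hu : IsNLWSolution ε u) (p : ℝ × E3) :
    box3 (fun p : ℝ × E3 => u p.1 p.2) p = -ε * u p.1 p.2 ^ 5 := by
  have hU : ContDiff ℝ 2 (fun p : ℝ × E3 => u p.1 p.2) := hu.contDiff_nat 2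
  have hd (w : ℝ × E3) :
      Differentiable ℝ (fun q => fderiv ℝ (fun p : ℝ × E3 => u p.1 p.2) q w) := by
    have h1 := (hU.fderiv_right (m := 1) (by norm_num)).differentiable (by norm_num)
    fun_prop
  obtain ⟨t, x⟩ := p
  have h := hu.eqn t x
  simp only [dtt, lap3, hu.dt_eq, hu.fderiv_eq] at h
  rw [deriv_slice (hd (1, 0)), fderiv_fderiv_apply_const hU] at h
  simp only [fun i => fderiv_slice (hd (0, bas3 i)) t x (bas3 i),
    fderiv_fderiv_apply_const hU] at h
  simp only [box3]
  linarith

theorem energyDensity3_eq (hu : IsNLWSolution ε u) (V : ℝ → ℝ) (t : ℝ) (x : E3) :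
    energyDensity3 (fun p : ℝ × E3 => u p.1 p.2) V (t, x) =
      1 / 2 * dt u t x ^ 2 + 1 / 2 * ‖fderiv ℝ (u t) x‖ ^ 2 + V (u t x) := by
  simp only [energyDensity3, norm_sq_fderiv_eq_sum, hu.dt_eq, hu.fderiv_eq]

theorem exists_eq_schwartz (hu : IsNLWSolution ε u) (t : ℝ) : ∃ g : 𝓢(E3, ℝ), u t = g := by
  obtain ⟨g, hg⟩ := hu.schwartz 0 t
  exact ⟨g, funext fun x => by simpa using hg x⟩

theorem exists_dt_eq_schwartz (hu : IsNLWSolution ε u) (t : ℝ) : ∃ g : 𝓢(E3, ℝ), dt u t = g := by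
  obtain ⟨g, hg⟩ := hu.schwartz 1 t
  exact ⟨g, funext fun x => by simpa [iteratedDeriv_one, dt] using hg x⟩

theorem integrable_energyDensity (hu : IsNLWSolution ε u) (t c : ℝ) {n : ℕ} (hn : Even n)
    (hn0 : n ≠ 0) :
    Integrable fun x =>
      1 / 2 * dt u t x ^ 2 + 1 / 2 * ‖fderiv ℝ (u t) x‖ ^ 2 + c * u t x ^ n := by
  obtain ⟨g, hg⟩ := hu.exists_eq_schwartz t
  obtain ⟨h, hh⟩ := hu.exists_dt_eq_schwartz t
  have h1 := h.integrable_pow3 2 (by norm_num)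
  have h2 := g.integrable_pow3 n hn0
  simp only [Real.norm_eq_abs, sq_abs, hn.pow_abs] at h1 h2
  rw [hg, hh]
  exact ((h1.const_mul _).add (g.integrable_norm_fderiv_sq.const_mul _)).add (h2.const_mul _)

theorem tendsto_fderiv_cocompact (hu : IsNLWSolution ε u) (t : ℝ) :
    Filter.Tendsto (fun x => fderiv ℝ (fun p : ℝ × E3 => u p.1 p.2) (t, x))
      (Filter.cocompact E3) (nhds 0) := by
  obtain ⟨g, hg⟩ := hu.exists_eq_schwartz t
  obtain ⟨h, hh⟩ := hu.exists_dt_eq_schwartz t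
  have h1 : Filter.Tendsto h (Filter.cocompact E3) (nhds 0) := zero_at_infty h.toZeroAtInfty
  have h2 : Filter.Tendsto (SchwartzMap.fderivCLM ℝ E3 ℝ g) (Filter.cocompact E3) (nhds 0) :=
    zero_at_infty (SchwartzMap.fderivCLM ℝ E3 ℝ g).toZeroAtInfty
  have h3 := (h1.norm).add h2.norm
  rw [norm_zero, norm_zero, add_zero] at h3
  refine squeeze_zero_norm (fun x => ?_) h3
  refine ContinuousLinearMap.opNorm_le_bound _ (by positivity) fun v => ?_
  have h4 : fderiv ℝ (fun p : ℝ × E3 => u p.1 p.2) (t, x) v =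
      v.1 * h x + SchwartzMap.fderivCLM ℝ E3 ℝ g x v.2 := by
    have hv : v = v.1 • ((1 : ℝ), (0 : E3)) + (0, v.2) := by ext <;> simp
    conv_lhs => rw [hv]
    rw [map_add, map_smul, ← hu.dt_eq, ← hu.fderiv_eq, hg, hh, SchwartzMap.fderivCLM_apply,
      smul_eq_mul]
  rw [h4, add_mul]
  refine (norm_add_le _ _).trans (add_le_add ?_ ?_)
  · rw [norm_mul, mul_comm]
    gcongr
    exact norm_fst_le v
  · refine (ContinuousLinearMap.le_opNorm _ _).trans ?_
    gcongr
    exact norm_snd_le v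

theorem energy_eq_of_nonneg (hu : IsNLWSolution ε u) (hε : |ε| = 1) {T : ℝ} (hT : 0 ≤ T) :
    (∫ x, (1 / 2 * dt u T x ^ 2 + 1 / 2 * ‖fderiv ℝ (u T) x‖ ^ 2 + ε / 6 * u T x ^ 6)) =
      ∫ x, (1 / 2 * dt u 0 x ^ 2 + 1 / 2 * ‖fderiv ℝ (u 0) x‖ ^ 2 + ε / 6 * u 0 x ^ 6) := by
  have h0 : Filter.Tendsto (u 0) (Filter.cocompact E3) (nhds 0) := by
    obtain ⟨g, hg⟩ := hu.exists_eq_schwartz 0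
    rw [hg]
    exact zero_at_infty g.toZeroAtInfty
  have hV (z : ℝ) : z ^ 2 / 2 = 1 / 2 * z ^ 2 := by ring
  simpa only [hu.energyDensity3_eq] using integral_energyDensity3_eq hε
    (hu.contDiff_nat 3) hu.box3_eq h0 (hu.tendsto_fderiv_cocompact 0)
    (by simpa only [hu.energyDensity3_eq, hV] using
      hu.integrable_energyDensity 0 (1 / 2) even_two two_ne_zero) hT
    (by simpa only [hu.energyDensity3_eq] using
      hu.integrable_energyDensity 0 (ε / 6) (by decide : Even 6) (by norm_num))
    (by simpa only [hu.energyDensity3_eq] using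
      hu.integrable_energyDensity T (ε / 6) (by decide : Even 6) (by norm_num))

theorem dt_comp_neg (u : ℝ → E3 → ℝ) (t : ℝ) (x : E3) :
    dt (fun s => u (-s)) t x = -dt u (-t) x :=
  deriv_comp_neg (fun s => u s x) t

/-- Time reversal. -/
theorem comp_neg (hu : IsNLWSolution ε u) : IsNLWSolution ε fun t => u (-t) where
  smooth := hu.smooth.comp (contDiff_fst.neg.prodMk contDiff_snd)
  schwartz k t := by
    obtain ⟨g, hg⟩ := hu.schwartz k (-t)
    refine ⟨(-1 : ℝ) ^ k • g, fun x => ?_⟩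
    rw [iteratedDeriv_comp_neg k (fun s => u s x), hg]
    rfl
  eqn t x := by
    have h : dtt (fun s => u (-s)) t x = dtt u (-t) x := by
      simp only [dtt, dt_comp_neg]
      rw [deriv.fun_neg, deriv_comp_neg (fun s => dt u s x), neg_neg]
    rw [h]
    exact hu.eqn (-t) x

end IsNLWSolution

/-- **Conservation of energy for Schwartz solutions of the energy-critical NLW.** -/
theorem energy_conservation (ε : ℝ) (hε : ε = 1 ∨ ε = -1)
    (u : ℝ → E3 → ℝ) (hu : IsNLWSolution ε u) :
    (∀ t : ℝ, Integrable (fun x =>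
        (1/2) * (dt u t x) ^ 2 + (1/2) * ‖fderiv ℝ (u t) x‖ ^ 2 + (ε/6) * (u t x) ^ 6)) ∧
    (∀ t : ℝ,
      (∫ x, ((1/2) * (dt u t x) ^ 2 + (1/2) * ‖fderiv ℝ (u t) x‖ ^ 2 + (ε/6) * (u t x) ^ 6)) =
      ∫ x, ((1/2) * (dt u 0 x) ^ 2 + (1/2) * ‖fderiv ℝ (u 0) x‖ ^ 2 + (ε/6) * (u 0 x) ^ 6)) := by
  have hε' : |ε| = 1 := by rcases hε with rfl | rfl <;> simp
  refine ⟨fun t => hu.integrable_energyDensity t (ε / 6) (by decide : Even 6) (by norm_num),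
    fun t => ?_⟩
  rcases le_total 0 t with ht | ht
  · exact hu.energy_eq_of_nonneg hε' ht
  · simpa [IsNLWSolution.dt_comp_neg] using
      hu.comp_neg.energy_eq_of_nonneg hε' (neg_nonneg.2 ht)

end
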